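/- arXiv:2408.08222 — 2 statements merged into one kernel-verified Lean document; each statement's English description precedes it below -/
import Mathlib

section
/- Let the per-sample losses ℓ_i : ℝ^d → ℝ and all mini-batch losses L(B;·) be γ-smooth, and assume the full loss L(θ) = (1/N) Σ_i ℓ_i(θ) satisfies ‖∇L(θ)‖ ≤ ζ for all θ. Let θ_t be a random vector, B_t a random batch of size b independent of θ_t with E[∇L(B_t;θ) | θ_t] = ∇L(θ) for every θ, let g_t = ∇L(B_t;θ_t) be nonzero almost surely, and let ρ_t be a bounded random variable with 0 ≤ ρ_t ≤ ρ̄ almost surely. Define the SAM stochastic gradient g_{t+1/2} = ∇L(B_t; θ_t + ρ_t g_t/‖g_t‖). Then E⟨∇L(θ_t), g_{t+1/2}⟩ ≥ E‖∇L(θ_t)‖² − γζρ̄. -/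
open MeasureTheory ProbabilityTheory RealInnerProductSpace

theorem measurable_gradient {E : Type*} [NormedAddCommGroup E] [InnerProductSpace ℝ E]
    [CompleteSpace E] [MeasurableSpace E] [BorelSpace E] (f : E → ℝ) :
    Measurable (gradient f) :=
  (InnerProductSpace.toDual ℝ E).symm.continuous.measurable.comp (measurable_fderiv ℝ f)

/-- Independence lets one average over the variable `B` with the other
variable `X` frozen, provided the averaged function is integrable. -/
theorem integral_comp_eq_of_indepFun {Ω β E : Type*} [MeasurableSpace Ω] [MeasurableSpace β]
    [MeasurableSpace E] {μ : Measure Ω} [IsProbabilityMeasure μ]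
    {B : Ω → β} {X : Ω → E} (hB : Measurable B) (hX : Measurable X) (h : IndepFun B X μ)
    {f : β × E → ℝ} (hf : Measurable f) (hfint : Integrable (fun ω => f (B ω, X ω)) μ) :
    ∫ ω, f (B ω, X ω) ∂μ = ∫ ω, ∫ ω', f (B ω', X ω) ∂μ ∂μ := by
  have := Measure.isProbabilityMeasure_map (μ := μ) hB.aemeasurable
  have := Measure.isProbabilityMeasure_map (μ := μ) hX.aemeasurable
  have hmap := (indepFun_iff_map_prod_eq_prod_map_map hB.aemeasurable hX.aemeasurable).1 h
  have hfint' : Integrable f ((μ.map B).prod (μ.map X)) := by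
    rw [← hmap]
    exact (integrable_map_measure hf.aestronglyMeasurable (hB.prodMk hX).aemeasurable).2 hfint
  calc ∫ ω, f (B ω, X ω) ∂μ = ∫ p, f p ∂(μ.map fun ω => (B ω, X ω)) :=
        (integral_map (hB.prodMk hX).aemeasurable hf.aestronglyMeasurable).symm
    _ = ∫ x, ∫ y, f (y, x) ∂(μ.map B) ∂(μ.map X) := by
        rw [hmap, integral_prod_symm _ hfint']
    _ = ∫ ω, ∫ y, f (y, X ω) ∂(μ.map B) ∂μ :=
        integral_map hX.aemeasurable
          hf.stronglyMeasurable.integral_prod_left'.aestronglyMeasurable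
    _ = ∫ ω, ∫ ω', f (B ω', X ω) ∂μ ∂μ := by
        congr 1
        ext ω
        exact integral_map hB.aemeasurable
          (hf.comp (measurable_id.prodMk measurable_const)).aestronglyMeasurable

/-- Claim 1 in the LETS-SAM convergence proof: suppose the per-sample
losses `ℓ_i` and all mini-batch losses `L(B;·)` are `γ`-smooth, and the full loss
`L` has gradients bounded by `ζ`. Let `θ_t` be a random iterate, `B_t` a random
batch of size `b` independent of `θ_t` whose mini-batch gradient is conditionally
unbiased given `θ_t` (`E[∇L(B_t;θ) | θ_t] = ∇L(θ)` for every `θ`), let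
`g_t = ∇L(B_t;θ_t)` be a.s. nonzero, and let `0 ≤ ρ_t ≤ ρ̄` a.s. Then the SAM
stochastic gradient `g_{t+1/2} = ∇L(B_t; θ_t + ρ_t g_t/‖g_t‖)` satisfies
`E⟨∇L(θ_t), g_{t+1/2}⟩ ≥ E‖∇L(θ_t)‖² - γζρ̄`. -/
theorem lets_sam_claim1
    {d N b : ℕ} (hN : 0 < N) (hb : 0 < b)
    {Ω : Type*} [MeasurableSpace Ω] (μ : Measure Ω) [IsProbabilityMeasure μ]
    (ℓ : Fin N → EuclideanSpace ℝ (Fin d) → ℝ)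
    (L : EuclideanSpace ℝ (Fin d) → ℝ)
    (hL : ∀ θ, L θ = (N : ℝ)⁻¹ * ∑ i, ℓ i θ)
    (Lb : (Fin b → Fin N) → EuclideanSpace ℝ (Fin d) → ℝ)
    (hLb : ∀ (Bp : Fin b → Fin N) θ, Lb Bp θ = (b : ℝ)⁻¹ * ∑ j, ℓ (Bp j) θ)
    (γ ζ ρbar : ℝ)
    (hℓdiff : ∀ i, Differentiable ℝ (ℓ i))
    (hℓsmooth : ∀ (i : Fin N) (x y : EuclideanSpace ℝ (Fin d)),
      ‖gradient (ℓ i) x - gradient (ℓ i) y‖ ≤ γ * ‖x - y‖)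
    (hLbdiff : ∀ Bp : Fin b → Fin N, Differentiable ℝ (Lb Bp))
    (hLbsmooth : ∀ (Bp : Fin b → Fin N) (x y : EuclideanSpace ℝ (Fin d)),
      ‖gradient (Lb Bp) x - gradient (Lb Bp) y‖ ≤ γ * ‖x - y‖)
    (hbound : ∀ x : EuclideanSpace ℝ (Fin d), ‖gradient L x‖ ≤ ζ)
    (θt : Ω → EuclideanSpace ℝ (Fin d)) (hθtmeas : Measurable θt)
    (B : Ω → (Fin b → Fin N)) (hBmeas : Measurable B)
    (hindep : IndepFun B θt μ)
    (hunbiased : ∀ θ : EuclideanSpace ℝ (Fin d),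
      μ[(fun ω => gradient (Lb (B ω)) θ) | MeasurableSpace.comap θt inferInstance]
        =ᵐ[μ] fun _ => gradient L θ)
    (gt : Ω → EuclideanSpace ℝ (Fin d))
    (hgt : ∀ ω, gt ω = gradient (Lb (B ω)) (θt ω))
    (hgne : ∀ᵐ ω ∂μ, gt ω ≠ 0)
    (ρ : Ω → ℝ) (hρ : ∀ᵐ ω ∂μ, 0 ≤ ρ ω ∧ ρ ω ≤ ρbar)
    (hIntInner : Integrable (fun ω =>
      ⟪gradient L (θt ω), gradient (Lb (B ω)) (θt ω + (ρ ω / ‖gt ω‖) • gt ω)⟫) μ)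
    (hIntGrad : Integrable (fun ω => ‖gradient L (θt ω)‖ ^ 2) μ) :
    ∫ ω, ⟪gradient L (θt ω), gradient (Lb (B ω)) (θt ω + (ρ ω / ‖gt ω‖) • gt ω)⟫ ∂μ
      ≥ (∫ ω, ‖gradient L (θt ω)‖ ^ 2 ∂μ) - γ * ζ * ρbar := by
  have hmeasL := measurable_gradient L
  have hmeasLb := fun Bp => measurable_gradient (Lb Bp)
  have hζ : 0 ≤ ζ := (norm_nonneg _).trans (hbound 0)
  let f : (Fin b → Fin N) × EuclideanSpace ℝ (Fin d) → ℝ :=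
    fun p => ⟪gradient L p.2, gradient (Lb p.1) p.2⟫
  have hf : Measurable f := measurable_from_prod_countable_right fun Bp =>
    hmeasL.inner (hmeasLb Bp)
  have hintGrad (x : EuclideanSpace ℝ (Fin d)) :
      Integrable (fun ω => gradient (Lb (B ω)) x) μ :=
    (Integrable.of_finite (μ := μ.map B) (f := fun Bp => gradient (Lb Bp) x)).comp_measurable
      hBmeas
  have hmean (x : EuclideanSpace ℝ (Fin d)) :
      ∫ ω, gradient (Lb (B ω)) x ∂μ = gradient L x := by
    rw [← integral_condExp hθtmeas.comap_le, integral_congr_ae (hunbiased x)]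
    simp
  have hdiff : ∀ᵐ ω ∂μ,
      ‖⟪gradient L (θt ω), gradient (Lb (B ω)) (θt ω + (ρ ω / ‖gt ω‖) • gt ω)⟫
        - f (B ω, θt ω)‖ ≤ γ * ζ * ρbar := by
    filter_upwards [hgne, hρ] with ω hg hr
    have hgpos : 0 < ‖gt ω‖ := norm_pos_iff.2 hg
    have hγ : 0 ≤ γ := by
      have := (norm_nonneg _).trans (hLbsmooth (B ω) (gt ω) 0)
      rw [sub_zero] at this
      exact nonneg_of_mul_nonneg_left this hgpos
    have hstep : ‖(ρ ω / ‖gt ω‖) • gt ω‖ = ρ ω := by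
      rw [norm_smul, Real.norm_of_nonneg (div_nonneg hr.1 hgpos.le), div_mul_cancel₀ _ hgpos.ne']
    have hlip := hLbsmooth (B ω) (θt ω + (ρ ω / ‖gt ω‖) • gt ω) (θt ω)
    rw [add_sub_cancel_left, hstep] at hlip
    rw [← inner_sub_right]
    calc _ ≤ ‖gradient L (θt ω)‖ * _ := norm_inner_le_norm _ _
      _ ≤ ζ * (γ * ρbar) := mul_le_mul (hbound _)
          (hlip.trans (mul_le_mul_of_nonneg_left hr.2 hγ)) (norm_nonneg _) hζ
      _ = γ * ζ * ρbar := by ring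
  have hfmeas : Measurable fun ω => f (B ω, θt ω) := hf.comp (hBmeas.prodMk hθtmeas)
  have hintDiff := Integrable.of_bound
    (hIntInner.aestronglyMeasurable.sub hfmeas.aestronglyMeasurable) _ hdiff
  have hintf : Integrable (fun ω => f (B ω, θt ω)) μ :=
    (hIntInner.sub hintDiff).congr (.of_forall fun ω => by simp)
  have hmain : ∫ ω, f (B ω, θt ω) ∂μ = ∫ ω, ‖gradient L (θt ω)‖ ^ 2 ∂μ := by
    rw [integral_comp_eq_of_indepFun hBmeas hθtmeas hindep hf hintf]
    congr 1
    ext ω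
    change ∫ ω', ⟪gradient L (θt ω), gradient (Lb (B ω')) (θt ω)⟫ ∂μ = _
    rw [integral_inner (hintGrad (θt ω)), hmean, real_inner_self_eq_norm_sq]
  have hle := norm_integral_le_of_norm_le_const hdiff
  rw [integral_sub hIntInner hintf, hmain, probReal_univ, mul_one, Real.norm_eq_abs] at hle
  linarith [(abs_le.1 hle).1]
end

section
/- Let f : ℝ^d → ℝ be γ-smooth with ‖∇f(θ)‖ ≤ ζ for all θ. Fix θ ∈ ℝ^d, a unit vector u ∈ ℝ^d (‖u‖ = 1), a step size η > 0, and a radius ρ ≥ 0, and set θ' = θ − η ∇f(θ + ρu). Then f(θ') ≤ f(θ) − η‖∇f(θ)‖² + ηργζ + γη²ζ² + (γ³η²ρ²)/2. -/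
open RealInnerProductSpace

/-- The descent lemma: a differentiable function whose gradient is `γ`-Lipschitz lies below its
quadratic upper model. -/
theorem le_quadratic_model_of_gradient_lipschitz {E : Type*} [NormedAddCommGroup E]
    [InnerProductSpace ℝ E] [CompleteSpace E] {f : E → ℝ} {γ : ℝ} (hdiff : Differentiable ℝ f)
    (hsmooth : ∀ x y, ‖gradient f x - gradient f y‖ ≤ γ * ‖x - y‖) (x v : E) :
    f (x + v) ≤ f x + ⟪gradient f x, v⟫ + γ / 2 * ‖v‖ ^ 2 := by
  have hderiv (t : ℝ) :
      HasDerivAt (fun t : ℝ ↦ f (x + t • v) - t * ⟪gradient f x, v⟫ - γ / 2 * ‖v‖ ^ 2 * t ^ 2)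
        (⟪gradient f (x + t • v), v⟫ - ⟪gradient f x, v⟫ - γ * ‖v‖ ^ 2 * t) t := by
    have hline : HasDerivAt (fun t : ℝ ↦ x + t • v) v t := by
      simpa using ((hasDerivAt_id t).smul_const v).const_add x
    have hf : HasDerivAt (fun t : ℝ ↦ f (x + t • v)) ⟪gradient f (x + t • v), v⟫ t := by
      exact (hdiff (x + t • v)).hasGradientAt.hasFDerivAt.comp_hasDerivAt t hline
    refine ((hf.sub ((hasDerivAt_id t).mul_const ⟪gradient f x, v⟫)).sub
      ((hasDerivAt_pow 2 t).const_mul (γ / 2 * ‖v‖ ^ 2))).congr_deriv ?_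
    push_cast
    ring
  have hanti : AntitoneOn
      (fun t : ℝ ↦ f (x + t • v) - t * ⟪gradient f x, v⟫ - γ / 2 * ‖v‖ ^ 2 * t ^ 2)
      (Set.Icc 0 1) := by
    refine antitoneOn_of_hasDerivWithinAt_nonpos (convex_Icc 0 1)
      (fun t _ ↦ (hderiv t).continuousAt.continuousWithinAt)
      (fun t _ ↦ (hderiv t).hasDerivWithinAt) fun t ht ↦ ?_
    rw [interior_Icc] at ht
    rw [← inner_sub_left, sub_nonpos]
    calc ⟪gradient f (x + t • v) - gradient f x, v⟫
        ≤ ‖gradient f (x + t • v) - gradient f x‖ * ‖v‖ := real_inner_le_norm _ _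
      _ ≤ γ * ‖x + t • v - x‖ * ‖v‖ := by gcongr; exact hsmooth _ _
      _ = γ * ‖v‖ ^ 2 * t := by
        rw [add_sub_cancel_left, norm_smul, Real.norm_of_nonneg ht.1.le]
        ring
  have h := hanti (Set.left_mem_Icc.2 zero_le_one) (Set.right_mem_Icc.2 zero_le_one) zero_le_one
  simp only [zero_smul, one_smul, add_zero] at h
  linarith

/-- per-iteration descent inequality for the deterministic (full-batch)
SAM update `θ' = θ - η • ∇f(θ + ρ • u)` with perturbation radius `ρ` along a unit
direction `u`, for a `γ`-smooth `f` with gradients bounded by `ζ`. -/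
theorem sam_one_step_descent
    {d : ℕ} (f : EuclideanSpace ℝ (Fin d) → ℝ) (γ ζ : ℝ)
    (hdiff : Differentiable ℝ f)
    (hsmooth : ∀ x y : EuclideanSpace ℝ (Fin d),
      ‖gradient f x - gradient f y‖ ≤ γ * ‖x - y‖)
    (hbound : ∀ x : EuclideanSpace ℝ (Fin d), ‖gradient f x‖ ≤ ζ)
    (θ u : EuclideanSpace ℝ (Fin d)) (hu : ‖u‖ = 1)
    (η : ℝ) (hη : 0 < η) (ρ : ℝ) (hρ : 0 ≤ ρ)
    (θ' : EuclideanSpace ℝ (Fin d)) (hθ' : θ' = θ - η • gradient f (θ + ρ • u)) :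
    f θ' ≤ f θ - η * ‖gradient f θ‖ ^ 2 + η * ρ * γ * ζ + γ * η ^ 2 * ζ ^ 2
      + γ ^ 3 * η ^ 2 * ρ ^ 2 / 2 := by
  subst hθ'
  have hγ : 0 ≤ γ := by
    have h := (norm_nonneg _).trans (hsmooth u 0)
    rwa [sub_zero, hu, mul_one] at h
  have hdescent := le_quadratic_model_of_gradient_lipschitz hdiff hsmooth θ
    (-(η • gradient f (θ + ρ • u)))
  rw [← sub_eq_add_neg, inner_neg_right, real_inner_smul_right, norm_neg, norm_smul,
    Real.norm_of_nonneg hη.le] at hdescent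
  have hlip : ‖gradient f θ - gradient f (θ + ρ • u)‖ ≤ γ * ρ := by
    simpa [norm_smul, hu, abs_of_nonneg hρ] using hsmooth θ (θ + ρ • u)
  have hinner : ‖gradient f θ‖ ^ 2 - ρ * γ * ζ ≤ ⟪gradient f θ, gradient f (θ + ρ • u)⟫ := by
    have h : ⟪gradient f θ, gradient f θ - gradient f (θ + ρ • u)⟫ ≤ ζ * (γ * ρ) :=
      (real_inner_le_norm _ _).trans
        (mul_le_mul (hbound θ) hlip (norm_nonneg _) ((norm_nonneg _).trans (hbound θ)))
    rw [inner_sub_right, real_inner_self_eq_norm_sq] at h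
    linarith
  have hnorm : ‖gradient f (θ + ρ • u)‖ ^ 2 ≤ ζ ^ 2 := by
    gcongr
    exact hbound _
  have hlinear := mul_le_mul_of_nonneg_left hinner hη.le
  have hquad := mul_le_mul_of_nonneg_left hnorm (by positivity : 0 ≤ γ / 2 * η ^ 2)
  have hslack : 0 ≤ γ / 2 * η ^ 2 * ζ ^ 2 + γ ^ 3 * η ^ 2 * ρ ^ 2 / 2 := by positivity
  linarith
end
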